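/- arXiv:2211.06682 — 9 statements merged into one kernel-verified Lean document; each statement's English description precedes it below -/
import Mathlib

section
/- If G is a finite simple graph of order n, then Mo*(G) ≤ (2/√3 − 1)·n³. -/
open Finset

/-- The parameter `Mo*(G)`: the sum over all edges `uv` of `G` of
`n - min {d_G(u), d_G(v)}`, where `n` is the order of `G`. -/
noncomputable def moStar {V : Type*} [Fintype V] (G : SimpleGraph V) : ℕ :=
  letI := Classical.decEq V
  letI : DecidableRel G.Adj := Classical.decRel _
  ∑ e ∈ G.edgeFinset,
    Sym2.lift ⟨fun u v => Fintype.card V - min (G.degree u) (G.degree v),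
      fun u v => by simp [min_comm]⟩ e

/-- The nonnegative root `c = 2 / √3 - 1` of `3 (c + 1) ^ 2 = 4` satisfies
`s (n - s) ^ 2 + c s ^ 3 ≤ c n ^ 3` for `s ≤ n`. -/
lemma mul_sq_add_mul_cube_le {c s n : ℝ} (hc : 3 * (c + 1) ^ 2 = 4) (hc0 : 0 ≤ c)
    (hsn : s ≤ n) : s * (n - s) ^ 2 + c * s ^ 3 ≤ c * n ^ 3 := by
  have hquad : 0 ≤ c * (n ^ 2 + n * s + s ^ 2) - s * (n - s) := by
    have h : (1 + c) * (c * (n ^ 2 + n * s + s ^ 2) - s * (n - s))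
        = ((1 + c) * s - (1 - c) * n / 2) ^ 2 := by
      linear_combination (n ^ 2 / 4) * hc
    have h' : 0 ≤ (1 + c) * (c * (n ^ 2 + n * s + s ^ 2) - s * (n - s)) := by
      rw [h]; positivity
    exact nonneg_of_mul_nonneg_right h' (by linarith)
  nlinarith [mul_nonneg (sub_nonneg.2 hsn) hquad]

/-- The extremal problem for integer sequences to which the bound on `moStar` reduces. -/
lemma sum_mul_sub_sum_le {c : ℝ} (hc : 3 * (c + 1) ^ 2 = 4) (hc0 : 0 ≤ c) (n : ℕ) :
    ∀ a : ℕ → ℕ, (∀ i < n, a i ≤ n) →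
      ∑ i ∈ range n, ((a i : ℝ) * (n - a i) - ∑ j ∈ range (a i), (a j : ℝ)) ≤ c * n ^ 3 := by
  induction n using Nat.strong_induction_on with
  | _ n ih =>
  intro a ha
  rcases Nat.eq_zero_or_pos n with rfl | hn
  · simp
  let g : ℕ → ℝ := fun t => (t : ℝ) * (n - t) - ∑ j ∈ range t, (a j : ℝ)
  obtain ⟨s, hs, hmax⟩ := exists_max_image (range n) g ⟨0, mem_range.2 hn⟩
  rw [mem_range] at hs
  have hg : ∀ t ≤ n, g t ≤ g s := by
    intro t ht
    rcases ht.lt_or_eq with ht | rfl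
    · exact hmax t (mem_range.2 ht)
    · refine le_trans ?_ (hmax 0 (mem_range.2 hn))
      have : (0 : ℝ) ≤ ∑ j ∈ range t, (a j : ℝ) := by positivity
      simp only [g, sub_self, mul_zero, range_zero, sum_empty, Nat.cast_zero, zero_mul]
      linarith
  let b : ℕ → ℕ := fun i => min (a i) s
  let h : ℕ → ℝ := fun t => (t : ℝ) * (n - t) - ∑ j ∈ range t, (b j : ℝ)
  have hgh : ∀ t, g t ≤ h t := fun t =>
    sub_le_sub_left (sum_le_sum fun j _ => Nat.cast_le.2 (min_le_left _ _)) _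
  have hlow : ∀ i < n, g (a i) ≤ h (b i) := by
    intro i hi
    rcases le_total (a i) s with hle | hle
    · simpa only [b, min_eq_left hle] using hgh (a i)
    · simpa only [b, min_eq_right hle] using (hg _ (ha i hi)).trans (hgh s)
  have hsplit : ∑ i ∈ range n, g (a i) =
      ∑ i ∈ range s, g (a i) + ∑ i ∈ Ico s n, g (a i) :=
    (sum_range_add_sum_Ico _ hs.le).symm
  have h1 : ∑ i ∈ range s, g (a i) ≤ ∑ i ∈ range s, h (b i) :=
    sum_le_sum fun i hi => hlow i ((mem_range.1 hi).trans hs)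
  have h2 : ∑ i ∈ Ico s n, g (a i) ≤ ((n : ℝ) - s) * h s := by
    have := sum_le_card_nsmul (Ico s n) (fun i => g (a i)) (h s)
      fun i hi => (hg _ (ha i (mem_Ico.1 hi).2)).trans (hgh s)
    simpa [Nat.cast_sub hs.le] using this
  have h3 : ∑ i ∈ range s, h (b i) =
      ∑ i ∈ range s, ((b i : ℝ) * (s - b i) - ∑ j ∈ range (b i), (b j : ℝ))
        + (n - s) * ∑ j ∈ range s, (b j : ℝ) := by
    rw [mul_sum, ← sum_add_distrib]
    exact sum_congr rfl fun i _ => by simp only [h]; ring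
  have h4 := ih s hs b fun i _ => min_le_right _ _
  have h5 := mul_sq_add_mul_cube_le hc hc0 (Nat.cast_le.2 hs.le : (s : ℝ) ≤ n)
  have h6 : h s = (s : ℝ) * (n - s) - ∑ j ∈ range s, (b j : ℝ) := rfl
  rw [h6] at h2
  change ∑ i ∈ range n, g (a i) ≤ _
  nlinarith

/-- A sum of a monotone sequence over a finite set of indices is at least the sum of the
initial segment of the same length. -/
lemma sum_range_card_le_sum {n : ℕ} {a : ℕ → ℕ} (ha : ∀ i j, i ≤ j → j < n → a i ≤ a j)
    (S : Finset ℕ) (hS : ∀ i ∈ S, i < n) : ∑ i ∈ range S.card, a i ≤ ∑ i ∈ S, a i := by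
  induction S using Finset.induction_on_max with
  | empty => simp
  | insert m S hm ih =>
    have hmS : m ∉ S := fun h => lt_irrefl _ (hm m h)
    have hcard : S.card ≤ m := by
      simpa using card_le_card (fun i hi => mem_range.2 (hm i hi) : S ⊆ range m)
    rw [card_insert_of_notMem hmS, sum_range_succ, sum_insert hmS, add_comm]
    exact add_le_add (ha _ _ hcard (hS m (mem_insert_self _ _)))
      (ih fun i hi => hS i (mem_insert_of_mem hi))

/-- Every function on a finite type is listed in nondecreasing order by some enumeration. -/
lemma exists_enumeration {V : Type*} [Fintype V] (f : V → ℕ) :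
    ∃ (e : V → ℕ) (a : ℕ → ℕ), Set.BijOn e Set.univ (Set.Iio (Fintype.card V)) ∧
      (∀ v, a (e v) = f v) ∧ ∀ i j, i ≤ j → j < Fintype.card V → a i ≤ a j := by
  let e₀ := Fintype.equivFin V
  let σ := Tuple.sort (f ∘ e₀.symm)
  have hmono : Monotone ((f ∘ e₀.symm) ∘ σ) := Tuple.monotone_sort _
  refine ⟨fun v => (σ.symm (e₀ v) : ℕ),
    fun i => if h : i < Fintype.card V then f (e₀.symm (σ ⟨i, h⟩)) else 0,
    ⟨fun v _ => (σ.symm (e₀ v)).2, ?_, ?_⟩, ?_, ?_⟩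
  · intro u _ v _ huv
    exact e₀.injective (σ.symm.injective (Fin.ext huv))
  · intro i hi
    exact ⟨e₀.symm (σ ⟨i, hi⟩), trivial, by simp⟩
  · intro v
    simp
  · intro i j hij hj
    simp only [hij.trans_lt hj, hj, dif_pos]
    exact hmono (show (⟨i, hij.trans_lt hj⟩ : Fin _) ≤ ⟨j, hj⟩ from hij)

/-- The extremal bound for the out-degrees of a finite directed graph with
out-neighborhoods `N`. -/
lemma sum_card_mul_sub_sum_card_le {V : Type*} [Fintype V] {c : ℝ}
    (hc : 3 * (c + 1) ^ 2 = 4) (hc0 : 0 ≤ c) (N : V → Finset V) :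
    ∑ u, (((N u).card : ℝ) * (Fintype.card V - (N u).card) - ∑ v ∈ N u, ((N v).card : ℝ))
      ≤ c * (Fintype.card V : ℝ) ^ 3 := by
  obtain ⟨e, a, he, hae, ha⟩ := exists_enumeration fun v => (N v).card
  have hlt : ∀ v, e v < Fintype.card V := fun v => he.mapsTo (Set.mem_univ v)
  have hinj : Function.Injective e := fun u v h => he.injOn trivial trivial h
  have hbound : ∀ i < Fintype.card V, a i ≤ Fintype.card V := by
    intro i hi
    obtain ⟨v, -, rfl⟩ := he.surjOn hi
    rw [hae]
    exact card_le_univ _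
  refine le_trans ?_ (sum_mul_sub_sum_le hc hc0 _ a hbound)
  rw [← sum_nbij (s := univ)
    (f := fun v => (a (e v) : ℝ) * (Fintype.card V - a (e v)) - ∑ j ∈ range (a (e v)), (a j : ℝ))
    e (fun v _ => mem_range.2 (hlt v)) hinj.injOn
    (fun i hi => by
      obtain ⟨v, -, rfl⟩ := he.surjOn (mem_range.1 hi)
      exact ⟨v, by simp, rfl⟩) fun _ _ => rfl]
  refine sum_le_sum fun u _ => ?_
  rw [hae]
  refine sub_le_sub_left ?_ _
  have h := sum_range_card_le_sum ha ((N u).map ⟨e, hinj⟩) fun i hi => by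
    obtain ⟨v, -, rfl⟩ := mem_map.1 hi
    exact hlt v
  rw [card_map, sum_map] at h
  simp only [Function.Embedding.coeFn_mk, hae] at h
  exact_mod_cast h

/-- If the keys refine the degree order and every edge points to its end of larger key, then
`moStar` is obtained by counting every edge at its tail. -/
lemma moStar_eq_sum_card_mul {V K : Type*} [Fintype V] [DecidableEq V] [LinearOrder K]
    (G : SimpleGraph V) [DecidableRel G.Adj] (k : V → K) (hk : Function.Injective k)
    (hd : ∀ u v, k u < k v → G.degree u ≤ G.degree v) :
    moStar G = ∑ u, #{v | G.Adj u v ∧ k u < k v} * (Fintype.card V - G.degree u) := by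
  simp_rw [← smul_eq_mul, ← sum_const]
  rw [sum_sigma', moStar]
  symm
  refine sum_nbij (fun p => s(p.1, p.2)) ?_ ?_ ?_ ?_
  · rintro ⟨u, v⟩ h
    simp only [mem_sigma, mem_filter, mem_univ, true_and] at h
    simpa using h.1
  · rintro ⟨u, v⟩ h ⟨u', v'⟩ h' heq
    simp only [coe_sigma, Set.mem_sigma_iff, coe_filter, Set.mem_ofPred_eq, mem_univ,
      true_and] at h h'
    rcases Sym2.eq_iff.1 heq with ⟨h1, h2⟩ | ⟨h1, h2⟩
    · dsimp only at h1 h2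
      subst h1 h2
      rfl
    · dsimp only at h1 h2
      subst h1 h2
      exact absurd (h.2.2.trans h'.2.2) (lt_irrefl _)
  · intro e he
    induction e using Sym2.ind with
    | _ u v =>
      have hadj : G.Adj u v := by simpa using he
      rcases lt_or_gt_of_ne (hk.ne hadj.ne) with h | h
      · exact ⟨⟨u, v⟩, by simp [hadj, h], rfl⟩
      · exact ⟨⟨v, u⟩, by simp [hadj.symm, h], Sym2.eq_swap⟩
  · rintro ⟨u, v⟩ h
    simp only [mem_sigma, mem_filter, mem_univ, true_and] at h
    simp only [Sym2.lift_mk]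
    have := hd u v h.2
    rw [eq_comm]
    convert congrArg (Fintype.card V - ·) (Nat.min_eq_left this)

theorem stmt0 {V : Type*} [Fintype V] (G : SimpleGraph V) (n : ℕ)
    (hn : Fintype.card V = n) :
    (moStar G : ℝ) ≤ (2 / Real.sqrt 3 - 1) * n ^ 3 := by
  classical
  subst hn
  have hsq : Real.sqrt 3 ^ 2 = 3 := Real.sq_sqrt (by norm_num)
  have hpos : 0 < Real.sqrt 3 := Real.sqrt_pos.2 (by norm_num)
  have hc : 3 * (2 / Real.sqrt 3 - 1 + 1) ^ 2 = 4 := by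
    rw [sub_add_cancel, div_pow, hsq]; norm_num
  have hc0 : 0 ≤ 2 / Real.sqrt 3 - 1 := by
    rw [sub_nonneg, one_le_div hpos]
    nlinarith
  let k : V → ℕ ×ₗ Fin (Fintype.card V) := fun v => toLex (G.degree v, Fintype.equivFin V v)
  have hk : Function.Injective k := fun u v h =>
    (Fintype.equivFin V).injective (congrArg (fun p => (ofLex p).2) h)
  have hd : ∀ u v, k u < k v → G.degree u ≤ G.degree v := fun u v h => by
    rcases Prod.Lex.lt_iff.1 h with h | h
    · exact h.le
    · exact h.1.le
  let N : V → Finset V := fun u => {v | G.Adj u v ∧ k u < k v}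
  let M : V → Finset V := fun u => {v | G.Adj u v ∧ k v < k u}
  have hdeg : ∀ u, G.degree u = #(N u) + #(M u) := fun u => by
    rw [← card_union_of_disjoint, ← G.card_neighborFinset_eq_degree]
    · congr 1
      ext v
      simp only [N, M, SimpleGraph.mem_neighborFinset, mem_union, mem_filter, mem_univ, true_and]
      refine ⟨fun h => ?_, fun h => h.elim And.left And.left⟩
      exact (lt_or_gt_of_ne (hk.ne h.ne)).imp (⟨h, ·⟩) (⟨h, ·⟩)
    · refine disjoint_left.2 fun v hv hv' => ?_
      exact lt_asymm (mem_filter.1 hv).2.2 (mem_filter.1 hv').2.2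
  have hwalk : ∑ u, ∑ v ∈ N u, (#(N v) : ℝ) = ∑ u, (#(N u) : ℝ) * #(M u) := by
    rw [sum_comm' (t' := univ) (s' := M) fun u v => by simp [N, M, G.adj_comm]]
    exact sum_congr rfl fun u _ => by rw [sum_const, nsmul_eq_mul, mul_comm]
  refine le_of_eq_of_le ?_ (sum_card_mul_sub_sum_card_le hc hc0 N)
  rw [moStar_eq_sum_card_mul G k hk hd, sum_sub_distrib, hwalk, ← sum_sub_distrib]
  push_cast
  refine sum_congr rfl fun u _ => ?_
  rw [Nat.cast_sub (G.degree_lt_card_verts u).le, hdeg u]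
  push_cast
  simp only [N]
  ring
end

section
/- If G is a finite simple graph of order n and maximum degree Δ, then Mo*(G) ≤ (2(Δ/n)² + (Δ/n) − 2(Δ/n)·√((Δ/n)² + (Δ/n)))·n³. -/
open Finset

/-- Summing a vertex weight over the endpoints of all edges counts each vertex `v` exactly
`G.degree v` times. -/
theorem SimpleGraph.sum_edgeFinset_sum_toFinset {V : Type*} [Fintype V] [DecidableEq V]
    (G : SimpleGraph V) [DecidableRel G.Adj] (w : V → ℝ) :
    ∑ e ∈ G.edgeFinset, ∑ v ∈ e.toFinset, w v = ∑ v, G.degree v * w v := by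
  rw [Finset.sum_comm' (t' := univ) (s' := fun v => G.incidenceFinset v)]
  · simp
  · intro e v
    simp [SimpleGraph.mem_incidenceFinset, SimpleGraph.incidenceSet]

/-- If every edge weight is at most `K` times the sum of the inverse degrees of its endpoints,
then the total edge weight is at most `K` times the order of the graph. -/
theorem SimpleGraph.sum_edgeFinset_le_card_mul {V : Type*} [Fintype V] [DecidableEq V]
    (G : SimpleGraph V) [DecidableRel G.Adj] (f : Sym2 V → ℝ) {K : ℝ} (hK : 0 ≤ K)
    (hf : ∀ u v, G.Adj u v → f s(u, v) ≤ K / G.degree u + K / G.degree v) :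
    ∑ e ∈ G.edgeFinset, f e ≤ Fintype.card V * K := by
  calc ∑ e ∈ G.edgeFinset, f e
      ≤ ∑ e ∈ G.edgeFinset, ∑ v ∈ e.toFinset, K / G.degree v := by
        refine Finset.sum_le_sum fun e he => ?_
        induction e with
        | _ u v =>
          have huv : G.Adj u v := by simpa using he
          rw [Sym2.toFinset_mk_eq, Finset.sum_pair huv.ne]
          exact hf u v huv
    _ = ∑ v, G.degree v * (K / G.degree v) := G.sum_edgeFinset_sum_toFinset _
    _ ≤ ∑ _v : V, K := by
        refine Finset.sum_le_sum fun v _ => ?_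
        rcases eq_or_ne (G.degree v : ℝ) 0 with h | h
        · simpa [h] using hK
        · exact (mul_div_cancel₀ K h).le
    _ = Fintype.card V * K := by simp

/-- If `t ^ 2 + 2 * D * t = n * D`, then `n - a ≤ t ^ 2 / a + t ^ 2 / b` for `0 < a` and
`0 < b ≤ D`. -/
theorem sub_le_sq_div_add_sq_div {n D t a b : ℝ} (h : t ^ 2 + 2 * D * t = n * D)
    (ha : 0 < a) (hb : 0 < b) (hbD : b ≤ D) : n - a ≤ t ^ 2 / a + t ^ 2 / b := by
  have hD : 0 < D := hb.trans_le hbD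
  have h_anti : t ^ 2 / D ≤ t ^ 2 / b := by gcongr
  have hn : n = 2 * t + t ^ 2 / D := by field_simp; linarith
  have h_amgm : 2 * t ≤ a + t ^ 2 / a := by
    have h_sq : a + t ^ 2 / a - 2 * t = (a - t) ^ 2 / a := by field_simp; ring
    have : 0 ≤ (a - t) ^ 2 / a := by positivity
    linarith
  linarith

open scoped Classical in
theorem stmt1 {V : Type*} [Fintype V] (G : SimpleGraph V) (n Δ : ℕ)
    (hn : Fintype.card V = n) (hΔ : G.maxDegree = Δ) :
    (moStar G : ℝ) ≤
      (2 * ((Δ : ℝ) / n) ^ 2 + (Δ : ℝ) / n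
        - 2 * ((Δ : ℝ) / n) * Real.sqrt (((Δ : ℝ) / n) ^ 2 + (Δ : ℝ) / n)) * n ^ 3 := by
  set x : ℝ := (Δ : ℝ) / n with hx
  have hx0 : 0 ≤ x := by positivity
  set s : ℝ := Real.sqrt (x ^ 2 + x)
  have hs : s ^ 2 = x ^ 2 + x := Real.sq_sqrt (by positivity)
  have h_bound : (2 * x ^ 2 + x - 2 * x * s) * n ^ 3
      = (Fintype.card V : ℝ) * (n * (s - x)) ^ 2 := by
    rw [hn]
    linear_combination (-(n : ℝ) ^ 3) * hs
  rw [h_bound, moStar, Nat.cast_sum]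
  refine G.sum_edgeFinset_le_card_mul _ (sq_nonneg _) fun u v huv => ?_
  have hn0 : (n : ℝ) ≠ 0 := by
    rw [← hn]
    exact_mod_cast (Fintype.card_pos_iff.mpr ⟨u⟩).ne'
  have hxn : x * n = Δ := by rw [hx]; field_simp
  have ht : ((n : ℝ) * (s - x)) ^ 2 + 2 * (Δ : ℝ) * (n * (s - x)) = n * Δ := by
    rw [← hxn]
    linear_combination (n : ℝ) ^ 2 * hs
  have h_pos {u v : V} (h : G.Adj u v) : (0 : ℝ) < G.degree u := by
    exact_mod_cast (G.degree_pos_iff_exists_adj u).mpr ⟨v, h⟩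
  have h_le (u : V) : (G.degree u : ℝ) ≤ Δ := by
    exact_mod_cast hΔ ▸ G.degree_le_maxDegree u
  have h_min : min (G.degree u) (G.degree v) ≤ Fintype.card V :=
    (min_le_left _ _).trans (G.degree_lt_card_verts u).le
  have h_cast : ((Fintype.card V - min (G.degree u) (G.degree v) : ℕ) : ℝ)
      = n - min (G.degree u : ℝ) (G.degree v) := by
    rw [Nat.cast_sub h_min, hn, Nat.cast_min]
  refine h_cast.trans_le ?_
  rcases le_total (G.degree u : ℝ) (G.degree v) with h | h
  · rw [min_eq_left h]
    exact sub_le_sq_div_add_sq_div ht (h_pos huv) (h_pos huv.symm) (h_le v)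
  · rw [min_eq_right h, add_comm]
    exact sub_le_sq_div_add_sq_div ht (h_pos huv.symm) (h_pos huv) (h_le u)
end

section
/- Let G be a connected finite simple graph of order n and let uv be an edge of G with n_G(u,v) ≥ n_G(v,u). Then |n_G(u,v) − n_G(v,u)| < n − min{d_G(u), d_G(v)}. -/
/-- `nNear G u v` is the number of vertices of `G` that are strictly closer to `u`
than to `v`. -/
noncomputable def nNear {V : Type*} [Fintype V] (G : SimpleGraph V) (u v : V) : ℕ :=
  Nat.card {w : V | G.dist w u < G.dist w v}

open scoped Classical in
theorem nNear_add_degree_le {V : Type*} [Fintype V] (G : SimpleGraph V) {u v : V}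
    (huv : G.Adj u v) : nNear G u v + G.degree v ≤ Fintype.card V := by
  have hA : nNear G u v = (Finset.univ.filter fun w ↦ G.dist w u < G.dist w v).card := by
    rw [nNear, Nat.card_eq_fintype_card]
    exact Fintype.card_subtype _
  have hmem : u ∈ G.neighborFinset v := by simpa using huv.symm
  have hv : v ∉ (G.neighborFinset v).erase u := by simp
  have hdeg : (insert v ((G.neighborFinset v).erase u)).card = G.degree v := by
    rw [Finset.card_insert_of_notMem hv, Finset.card_erase_add_one hmem,
      G.card_neighborFinset_eq_degree]
  rw [hA, ← hdeg, ← Finset.card_union_of_disjoint]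
  · exact Finset.card_le_univ _
  · rw [Finset.disjoint_right]
    intro w hw hwA
    simp only [Finset.mem_filter, Finset.mem_univ, true_and] at hwA
    simp only [Finset.mem_insert, Finset.mem_erase, SimpleGraph.mem_neighborFinset] at hw
    rcases hw with rfl | ⟨hne, hadj⟩
    · simp at hwA
    · have hwv : G.dist w v = 1 := SimpleGraph.dist_eq_one_iff_adj.mpr hadj.symm
      have huw : G.Reachable w u := hadj.symm.reachable.trans huv.symm.reachable
      exact absurd (huw.pos_dist_of_ne hne) (by omega)

theorem nNear_pos {V : Type*} [Fintype V] (G : SimpleGraph V) {u v : V}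
    (huv : G.Adj u v) : 0 < nNear G u v := by
  have hu : u ∈ {w : V | G.dist w u < G.dist w v} := by
    simp [SimpleGraph.dist_eq_one_iff_adj.mpr huv]
  have : Nonempty {w : V | G.dist w u < G.dist w v} := ⟨⟨u, hu⟩⟩
  exact Nat.card_pos

open scoped Classical in
theorem stmt3 {V : Type*} [Fintype V] (G : SimpleGraph V) (hG : G.Connected)
    (n : ℕ) (hn : Fintype.card V = n) (u v : V) (huv : G.Adj u v)
    (h : nNear G v u ≤ nNear G u v) :
    |(nNear G u v : ℤ) - (nNear G v u : ℤ)| <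
      (n : ℤ) - min (G.degree u : ℤ) (G.degree v : ℤ) := by
  have hle := nNear_add_degree_le G huv
  have hpos := nNear_pos G huv.symm
  have hmin := min_le_right (G.degree u : ℤ) (G.degree v : ℤ)
  rw [abs_of_nonneg (by omega)]
  omega
end

section
/- Let G be a connected finite simple graph. There is no cycle u₁u₂…u_ℓu₁ in G such that n_G(u₁,u_ℓ) > n_G(u_ℓ,u₁) and, for every i ∈ {1,…,ℓ−1}, n_G(u_{i+1},u_i) ≥ n_G(u_i,u_{i+1}). Equivalently, the partial orientation of G that orients every edge uv with n_G(u,v) > n_G(v,u) from v towards u admits no cycle of G all of whose edges are oriented consistently or unoriented, with at least one edge oriented. -/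
/-- The sum of the distances in `G` from all vertices to `v`. -/
noncomputable def totalDist {V : Type*} [Fintype V] (G : SimpleGraph V) (v : V) : ℕ :=
  ∑ w, G.dist w v

open scoped Classical in
theorem nNear_eq_sum {V : Type*} [Fintype V] (G : SimpleGraph V) (u v : V) :
    nNear G u v = ∑ w, if G.dist w u < G.dist w v then 1 else 0 := by
  rw [nNear, Finset.sum_boole, Nat.cast_id, Nat.card_eq_fintype_card, Fintype.card_subtype]
  rfl

/-- Along an edge the total distance changes by the difference of the two values of `nNear`. -/
theorem totalDist_add_nNear {V : Type*} [Fintype V] {G : SimpleGraph V} (hG : G.Connected)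
    {u v : V} (huv : G.Adj u v) :
    totalDist G u + nNear G u v = totalDist G v + nNear G v u := by
  classical
  simp only [totalDist, nNear_eq_sum, ← Finset.sum_add_distrib]
  refine Finset.sum_congr rfl fun w _ => ?_
  have huv1 : G.dist u v = 1 := SimpleGraph.dist_eq_one_iff_adj.mpr huv
  have hvu1 : G.dist v u = 1 := SimpleGraph.dist_eq_one_iff_adj.mpr huv.symm
  have h1 := hG.dist_triangle (u := w) (v := u) (w := v)
  have h2 := hG.dist_triangle (u := w) (v := v) (w := u)
  split_ifs <;> omega

/-- There is no cycle `u 0, u 1, …, u (ℓ-1), u 0` in the connected graph `G` whose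
last edge satisfies `n_G(u 0, u (ℓ-1)) > n_G(u (ℓ-1), u 0)` (i.e. it is oriented from
`u (ℓ-1)` towards `u 0`) while every other edge `u i, u (i+1)` satisfies
`n_G(u (i+1), u i) ≥ n_G(u i, u (i+1))` (i.e. it is oriented consistently or unoriented). -/
theorem stmt5 {V : Type*} [Fintype V] (G : SimpleGraph V) (hG : G.Connected) :
    ¬ ∃ (ℓ : ℕ) (u : ℕ → V), 3 ≤ ℓ ∧
        (∀ i j, i < ℓ → j < ℓ → u i = u j → i = j) ∧
        (∀ i, i + 1 < ℓ → G.Adj (u i) (u (i + 1))) ∧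
        G.Adj (u (ℓ - 1)) (u 0) ∧
        nNear G (u (ℓ - 1)) (u 0) < nNear G (u 0) (u (ℓ - 1)) ∧
        (∀ i, i + 1 < ℓ → nNear G (u i) (u (i + 1)) ≤ nNear G (u (i + 1)) (u i)) := by
  rintro ⟨ℓ, u, hℓ, -, hadj, hlast, hlt, hle⟩
  have hmono : ∀ i, i < ℓ → totalDist G (u i) ≤ totalDist G (u 0) := by
    intro i
    induction i with
    | zero => exact fun _ => le_rfl
    | succ i ih =>
      intro hi
      have hstep := totalDist_add_nNear hG (hadj i hi)
      have := hle i hi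
      have := ih (by omega)
      omega
  have hend := totalDist_add_nNear hG hlast
  have := hmono (ℓ - 1) (by omega)
  omega
end

section
/- If G is a connected finite simple graph of diameter at most 2, then Mo(G) = irr(G). -/
open Finset

/-- The Mostar index `Mo(G) = ∑_{uv ∈ E(G)} |n_G(u,v) - n_G(v,u)|`. -/
noncomputable def mostar {V : Type*} [Fintype V] (G : SimpleGraph V) : ℕ :=
  letI := Classical.decEq V
  letI : DecidableRel G.Adj := Classical.decRel _
  ∑ e ∈ G.edgeFinset,
    Sym2.lift ⟨fun u v => ((nNear G u v : ℤ) - (nNear G v u : ℤ)).natAbs,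
      fun u v => by dsimp only; omega⟩ e

/-- The irregularity `irr(G) = ∑_{uv ∈ E(G)} |d_G(u) - d_G(v)|`. -/
noncomputable def irr {V : Type*} [Fintype V] (G : SimpleGraph V) : ℕ :=
  letI := Classical.decEq V
  letI : DecidableRel G.Adj := Classical.decRel _
  ∑ e ∈ G.edgeFinset,
    Sym2.lift ⟨fun u v => ((G.degree u : ℤ) - (G.degree v : ℤ)).natAbs,
      fun u v => by dsimp only; omega⟩ e

/-- If all distances are at most 2, the vertices strictly closer to `u` than to an adjacent
vertex `v` are `u` and the neighbors of `u` other than `v` that are not neighbors of `v`. -/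
lemma dist_lt_dist_iff_of_adj {V : Type*} {G : SimpleGraph V} (hG : G.Connected)
    (hdiam : ∀ u v : V, G.dist u v ≤ 2) {u v : V} (h : G.Adj u v) (w : V) :
    G.dist w u < G.dist w v ↔ w = u ∨ w ≠ v ∧ G.Adj u w ∧ ¬ G.Adj v w := by
  have hu : G.dist w u = 0 ↔ w = u := hG.dist_eq_zero_iff
  have hv : G.dist w v = 0 ↔ w = v := hG.dist_eq_zero_iff
  have hu1 : G.dist w u = 1 ↔ G.Adj u w := by
    rw [SimpleGraph.dist_eq_one_iff_adj, G.adj_comm]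
  have hv1 : G.dist w v = 1 ↔ G.Adj v w := by
    rw [SimpleGraph.dist_eq_one_iff_adj, G.adj_comm]
  have := hdiam w u
  have := hdiam w v
  have := h.ne
  grind

lemma nNear_add_card_commonNeighbors {V : Type*} [Fintype V] [DecidableEq V]
    {G : SimpleGraph V} [DecidableRel G.Adj] (hG : G.Connected)
    (hdiam : ∀ u v : V, G.dist u v ≤ 2) {u v : V} (h : G.Adj u v) :
    nNear G u v + #(G.neighborFinset u ∩ G.neighborFinset v) = G.degree u := by
  have hset : {w : V | G.dist w u < G.dist w v} =
      ↑(insert u ((G.neighborFinset u \ G.neighborFinset v).erase v)) := by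
    ext w
    simp [dist_lt_dist_iff_of_adj hG hdiam h, and_comm]
  have hcard : nNear G u v = #(G.neighborFinset u \ G.neighborFinset v) := by
    rw [nNear, hset, Nat.card_coe_set_eq, Set.ncard_coe_finset,
      card_insert_of_notMem (by simp), card_erase_add_one (by simp [h])]
  rw [hcard, card_sdiff_add_card_inter, G.card_neighborFinset_eq_degree]

theorem stmt6 {V : Type*} [Fintype V] (G : SimpleGraph V) (hG : G.Connected)
    (hdiam : ∀ u v : V, G.dist u v ≤ 2) :
    mostar G = irr G := by
  classical
  unfold mostar irr
  refine sum_congr rfl fun e he => ?_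
  induction e with | _ u v
  have h : G.Adj u v := by simpa using he
  have huv := nNear_add_card_commonNeighbors hG hdiam h
  have hvu := nNear_add_card_commonNeighbors hG hdiam h.symm
  rw [inter_comm] at hvu
  simp only [Sym2.lift_mk]
  convert_to ((nNear G u v : ℤ) - nNear G v u).natAbs = ((G.degree u : ℤ) - G.degree v).natAbs
  omega
end

section
/- For every positive integer n there exists a finite simple graph G of order n such that G maximizes Mo* among all graphs of order n (i.e., Mo*(G) ≥ Mo*(G') for every graph G' of order n) and such that, with δ denoting the minimum degree of G, the vertex set of G can be partitioned into an independent set I of size n − δ, each of whose vertices has degree exactly δ, and a set C of size δ such that every vertex of I is adjacent to every vertex of C. -/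
open Finset

section OrientedDegrees

variable {V : Type*} [Fintype V]

open scoped Classical in
/-- The neighbors of `u` of larger rank. -/
noncomputable def upNeighbors (G : SimpleGraph V) (r : V → ℕ) (u : V) : Finset V :=
  univ.filter fun w => G.Adj u w ∧ r u < r w

open scoped Classical in
theorem mem_upNeighbors {G : SimpleGraph V} {r : V → ℕ} {u w : V} :
    w ∈ upNeighbors G r u ↔ G.Adj u w ∧ r u < r w := by
  simp [upNeighbors]

open scoped Classical in
theorem moStar_eq_sum_upNeighbors (G : SimpleGraph V) {r : V → ℕ} (hr : Function.Injective r) :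
    (moStar G : ℤ) = ∑ u, ∑ w ∈ upNeighbors G r u,
      ((Fintype.card V : ℤ) - min (G.degree u : ℤ) (G.degree w)) := by
  have key : moStar G = ∑ p ∈ univ.sigma (upNeighbors G r),
      (Fintype.card V - min (G.degree p.1) (G.degree p.2)) := by
    unfold moStar
    symm
    refine Finset.sum_bij (fun p _ => s(p.1, p.2)) ?_ ?_ ?_ ?_
    · rintro ⟨u, w⟩ h
      simp only [mem_sigma, mem_upNeighbors] at h
      simpa using h.2.1
    · rintro ⟨u, w⟩ h ⟨u', w'⟩ h' he
      simp only [mem_sigma, mem_upNeighbors] at h h'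
      simp only [Sym2.eq_iff] at he
      rcases he with ⟨rfl, rfl⟩ | ⟨rfl, rfl⟩
      · rfl
      · omega
    · intro e
      induction e using Sym2.ind with
      | _ u w =>
        intro h
        have h : G.Adj u w := by simpa using h
        rcases lt_or_gt_of_ne (fun e => h.ne (hr e)) with hlt | hlt
        · exact ⟨⟨u, w⟩, by simp [mem_upNeighbors, h, hlt], rfl⟩
        · exact ⟨⟨w, u⟩, by simp [mem_upNeighbors, h.symm, hlt], Sym2.eq_swap⟩
    · rintro ⟨u, w⟩ h
      simp only [Sym2.lift_mk]
  rw [key, Finset.sum_sigma]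
  push_cast
  refine Finset.sum_congr rfl fun u _ => Finset.sum_congr rfl fun w _ => ?_
  rw [Nat.cast_sub ((min_le_left _ _).trans (G.degree_lt_card_verts u).le)]
  push_cast
  rfl

open scoped Classical in
theorem sum_upNeighbors_card_sub_degree (G : SimpleGraph V) {r : V → ℕ}
    (hr : Function.Injective r) (c : ℤ) :
    ∑ u, ∑ _w ∈ upNeighbors G r u, (c - G.degree u) =
      ∑ u, ((#(upNeighbors G r u) : ℤ) * (c - #(upNeighbors G r u)) -
        ∑ w ∈ upNeighbors G r u, (#(upNeighbors G r w) : ℤ)) := by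
  have hdeg (u : V) : (G.degree u : ℤ) =
      #(upNeighbors G r u) + #(univ.filter fun w => G.Adj w u ∧ r w < r u) := by
    rw [← G.card_neighborFinset_eq_degree, ← Nat.cast_add, ← card_union_of_disjoint]
    · congr 2
      ext w
      have : G.Adj u w → r u ≠ r w := fun h e => h.ne (hr e)
      simp only [SimpleGraph.mem_neighborFinset, mem_union, mem_upNeighbors, mem_filter, mem_univ,
        true_and, G.adj_comm w u]
      constructor
      · intro h
        exact (lt_or_gt_of_ne (this h)).imp (⟨h, ·⟩) (⟨h, ·⟩)
      · tauto
    · rw [disjoint_left]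
      intro w
      simp only [mem_upNeighbors, mem_filter, mem_univ, true_and]
      omega
  have hswap : ∑ u, ∑ w ∈ upNeighbors G r u, (#(upNeighbors G r w) : ℤ) =
      ∑ u, (#(upNeighbors G r u) : ℤ) * #(univ.filter fun w => G.Adj w u ∧ r w < r u) := by
    simp only [upNeighbors, Finset.sum_filter]
    rw [Finset.sum_comm]
    refine Finset.sum_congr rfl fun u _ => ?_
    rw [← Finset.sum_filter, Finset.sum_const, nsmul_eq_mul, mul_comm]
  rw [Finset.sum_sub_distrib, hswap, ← Finset.sum_sub_distrib]
  refine Finset.sum_congr rfl fun u _ => ?_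
  rw [Finset.sum_const, nsmul_eq_mul, hdeg u]
  ring

end OrientedDegrees

theorem Antitone.sum_Ico_le_sum {a : ℕ → ℕ} (ha : Antitone a) {n : ℕ} {S : Finset ℕ}
    (hS : S ⊆ range n) : ∑ j ∈ Ico (n - #S) n, a j ≤ ∑ j ∈ S, a j := by
  have hcard : #S ≤ n := by simpa using card_le_card hS
  set T := Ico (n - #S) n with hT
  have hTS : #T = #S := by rw [hT, Nat.card_Ico]; omega
  have hdiff : #(T \ S) = #(S \ T) := by
    have h1 := card_sdiff_add_card_inter T S
    have h2 := card_sdiff_add_card_inter S T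
    rw [inter_comm] at h2
    omega
  have hle : ∑ j ∈ T \ S, a j ≤ ∑ j ∈ S \ T, a j := by
    calc ∑ j ∈ T \ S, a j ≤ #(T \ S) • a (n - #S) := by
          refine sum_le_card_nsmul _ _ _ fun j hj => ha ?_
          simp only [hT, mem_sdiff, mem_Ico] at hj
          exact hj.1.1
      _ = #(S \ T) • a (n - #S) := by rw [hdiff]
      _ ≤ ∑ j ∈ S \ T, a j := by
          refine card_nsmul_le_sum _ _ _ fun j hj => ha ?_
          simp only [hT, mem_sdiff, mem_Ico] at hj
          have := mem_range.1 (hS hj.1)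
          omega
  have h1 := sum_inter_add_sum_sdiff T S a
  have h2 := sum_inter_add_sum_sdiff S T a
  rw [inter_comm] at h2
  omega

/-- The value `∑ (n - d(u))` over the edges `uv`, `u < v`, of the graph on `{0, …, n - 1}` in which
each `u` is joined to the last `a u` vertices. -/
def nestedValue (n : ℕ) (a : ℕ → ℕ) : ℤ :=
  ∑ i ∈ range n, ((a i : ℤ) * (n - a i) - ∑ j ∈ Ico (n - a i) n, (a j : ℤ))

/-- Antitone sequences in which the last `a i` elements of `{0, …, n - 1}` all exceed `i`. -/
structure IsNested (n : ℕ) (a : ℕ → ℕ) : Prop where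
  antitone : Antitone a
  add_lt : ∀ i < n, i + a i < n

theorem exists_isNested_moStar_le {n : ℕ} (G : SimpleGraph (Fin n)) :
    ∃ a, IsNested n a ∧ (moStar G : ℤ) ≤ nestedValue n a := by
  classical
  obtain ⟨d, hd⟩ : ∃ d : Fin n → ℕ, ∀ v, d v = G.degree v := ⟨_, fun _ => rfl⟩
  obtain ⟨σ, hσ⟩ : ∃ σ : Equiv.Perm (Fin n), Monotone fun i => d (σ i) :=
    ⟨_, Tuple.monotone_sort d⟩
  let r : Fin n → ℕ := fun v => σ.symm v
  have hr : Function.Injective r := Fin.val_injective.comp σ.symm.injective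
  have hdeg {u w : Fin n} (h : r u < r w) : G.degree u ≤ G.degree w := by
    simpa [← hd] using hσ (Fin.le_def.2 h.le)
  let o : Fin n → ℕ := fun v => #(upNeighbors G r v)
  have ho (v : Fin n) : r v + o v < n := by
    have h1 : (upNeighbors G r v).image r ⊆ Ioo (r v) n := by
      intro x hx
      obtain ⟨w, hw, rfl⟩ := mem_image.1 hx
      exact mem_Ioo.2 ⟨(mem_upNeighbors.1 hw).2, (σ.symm w).2⟩
    have h2 := card_le_card h1
    rw [card_image_of_injective _ hr, Nat.card_Ioo] at h2
    have : r v < n := (σ.symm v).2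
    change #(upNeighbors G r v) ≤ _ at h2
    simp only [o]
    omega
  obtain ⟨τ, hτ⟩ : ∃ τ : Equiv.Perm (Fin n), Antitone fun i => o (τ i) :=
    ⟨_, Tuple.monotone_sort fun v => OrderDual.toDual (o v)⟩
  have hτr : Function.Injective fun i => r (τ i) := hr.comp τ.injective
  have hτs : Function.Injective fun v => (τ.symm v : ℕ) :=
    Fin.val_injective.comp τ.symm.injective
  let a : ℕ → ℕ := fun i => if h : i < n then o (τ ⟨i, h⟩) else 0
  have haτ (i : Fin n) : a i = o (τ i) := by simp [a]
  have ha : Antitone a := by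
    intro i j hij
    by_cases hj : j < n
    · have hi : i < n := hij.trans_lt hj
      simpa [a, hi, hj] using hτ (a := ⟨i, hi⟩) (b := ⟨j, hj⟩) hij
    · simp [a, hj]
  refine ⟨a, ⟨ha, ?_⟩, ?_⟩
  · intro i hi
    have h1 : (Iic (⟨i, hi⟩ : Fin n)).image (fun j => r (τ j)) ⊆ range (n - a i) := by
      intro x hx
      obtain ⟨j, hj, rfl⟩ := mem_image.1 hx
      have h2 := ha (Fin.le_def.1 (mem_Iic.1 hj))
      rw [haτ j] at h2
      have h3 := ho (τ j)
      simp only [mem_range] at h2 ⊢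
      omega
    have h2 := card_le_card h1
    rw [card_image_of_injective _ hτr, card_range, Fin.card_Iic] at h2
    simp only at h2
    omega
  · rw [moStar_eq_sum_upNeighbors G hr]
    have h1 : ∑ u, ∑ w ∈ upNeighbors G r u,
        ((Fintype.card (Fin n) : ℤ) - min (G.degree u : ℤ) (G.degree w)) =
        ∑ u, ∑ _w ∈ upNeighbors G r u, ((n : ℤ) - G.degree u) := by
      refine Finset.sum_congr rfl fun u _ => Finset.sum_congr rfl fun w hw => ?_
      have := hdeg (mem_upNeighbors.1 hw).2
      rw [min_eq_left (by exact_mod_cast this), Fintype.card_fin]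
    have h2 := sum_upNeighbors_card_sub_degree G hr n
    refine le_of_eq_of_le (by convert h1) (le_of_eq_of_le (by convert h2) ?_)
    unfold nestedValue
    rw [← Equiv.sum_comp τ, Finset.sum_range]
    refine Finset.sum_le_sum fun i _ => ?_
    have hcard : #((upNeighbors G r (τ i)).image fun w => (τ.symm w : ℕ)) = a i := by
      rw [card_image_of_injective _ hτs, haτ]
    have h3 := ha.sum_Ico_le_sum (n := n)
      (S := (upNeighbors G r (τ i)).image fun w => (τ.symm w : ℕ)) (by
        intro x hx
        obtain ⟨w, _, rfl⟩ := mem_image.1 hx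
        simp)
    rw [hcard, Finset.sum_image hτs.injOn] at h3
    simp only [haτ, Equiv.apply_symm_apply] at h3
    have h4 : (∑ j ∈ Ico (n - o (τ i)) n, (a j : ℤ)) ≤
        ∑ w ∈ upNeighbors G r (τ i), (o w : ℤ) := by exact_mod_cast h3
    rw [haτ]
    simp only [o] at h4 ⊢
    linarith

/-- A nested sequence can be made constant on the first `n - a 0` indices without decreasing its
value. -/
theorem IsNested.exists_forall_eq {n : ℕ} (hn : 0 < n) {a : ℕ → ℕ} (ha : IsNested n a) :
    ∃ b, IsNested n b ∧ nestedValue n a ≤ nestedValue n b ∧ ∀ i, i + b 0 < n → b i = b 0 := by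
  induction hd : a 0 using Nat.strong_induction_on generalizing a with
  | _ d ih =>
    have hd0 : d < n := by simpa [hd] using ha.add_lt 0 hn
    have hle (i : ℕ) : a i ≤ d := hd ▸ ha.antitone i.zero_le
    let g : ℕ → ℤ := fun i => (a i : ℤ) * (n - a i) - ∑ j ∈ Ico (n - a i) n, (a j : ℤ)
    obtain ⟨m, hm, hmax⟩ := exists_max_image (range (n - d)) g ⟨0, by simpa using hd0⟩
    rw [mem_range] at hm
    let b : ℕ → ℕ := fun i => if i < n - d then a m else a i
    have hb_lt {i : ℕ} (h : i < n - d) : b i = a m := if_pos h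
    have hb_ge {i : ℕ} (h : n - d ≤ i) : b i = a i := if_neg h.not_gt
    have hb : IsNested n b := by
      refine ⟨fun i j hij => ?_, fun i hi => ?_⟩
      · rcases lt_or_ge j (n - d) with hj | hj
        · rw [hb_lt hj, hb_lt (hij.trans_lt hj)]
        · rw [hb_ge hj]
          rcases lt_or_ge i (n - d) with hi | hi
          · rw [hb_lt hi]
            exact ha.antitone (hm.le.trans hj)
          · rw [hb_ge hi]
            exact ha.antitone hij
      · rcases lt_or_ge i (n - d) with h | h
        · rw [hb_lt h]
          have := hle m
          omega
        · rw [hb_ge h]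
          exact ha.add_lt i hi
    have htail (k : ℕ) (hk : k ≤ d) :
        ∑ j ∈ Ico (n - k) n, (b j : ℤ) = ∑ j ∈ Ico (n - k) n, (a j : ℤ) := by
      refine Finset.sum_congr rfl fun j hj => ?_
      rw [mem_Ico] at hj
      rw [hb_ge (by omega)]
    have hval : nestedValue n a ≤ nestedValue n b := by
      refine Finset.sum_le_sum fun i _ => ?_
      rcases lt_or_ge i (n - d) with h | h
      · rw [hb_lt h, htail _ (hle m)]
        exact hmax i (mem_range.2 h)
      · rw [hb_ge h, htail _ (hle i)]
    have hb0 : b 0 = a m := hb_lt (by omega)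
    rcases (hle m).lt_or_eq with h | h
    · obtain ⟨c, hc, hv, hc'⟩ := ih (a m) h hb hb0
      exact ⟨c, hc, hval.trans hv, hc'⟩
    · refine ⟨b, hb, hval, fun i hi => ?_⟩
      rw [hb0, h] at hi
      rw [hb0, hb_lt (by omega)]

/-- The graph on `{0, …, n - 1}` in which each `i` is joined to those of the last `a i` vertices
that exceed it. -/
def nestedGraph (n : ℕ) (a : ℕ → ℕ) : SimpleGraph (Fin n) where
  Adj i j := ((i : ℕ) < j ∧ n ≤ j + a i) ∨ ((j : ℕ) < i ∧ n ≤ i + a j)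
  symm := ⟨fun _ _ h => h.symm⟩
  loopless := ⟨fun _ h => by omega⟩

theorem IsNested.upNeighbors_nestedGraph {n : ℕ} {a : ℕ → ℕ} (ha : IsNested n a) (i : Fin n) :
    (upNeighbors (nestedGraph n a) Fin.val i).image Fin.val = Ico (n - a i) n := by
  ext x
  simp only [mem_image, mem_upNeighbors, mem_Ico, nestedGraph]
  have := ha.add_lt i i.2
  constructor
  · rintro ⟨j, h, rfl⟩
    omega
  · rintro ⟨h1, h2⟩
    refine ⟨⟨x, h2⟩, ?_, rfl⟩
    simp only
    omega

open scoped Classical in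
theorem IsNested.sum_upNeighbors_nestedGraph {n : ℕ} {a : ℕ → ℕ} (ha : IsNested n a) :
    ∑ u, ∑ _w ∈ upNeighbors (nestedGraph n a) Fin.val u,
      ((n : ℤ) - (nestedGraph n a).degree u) = nestedValue n a := by
  have hcard (i : Fin n) : #(upNeighbors (nestedGraph n a) Fin.val i) = a i := by
    have := ha.add_lt i i.2
    rw [← card_image_of_injective _ Fin.val_injective, ha.upNeighbors_nestedGraph, Nat.card_Ico]
    omega
  rw [sum_upNeighbors_card_sub_degree _ Fin.val_injective, nestedValue, Finset.sum_range]
  refine Finset.sum_congr rfl fun i _ => ?_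
  rw [← ha.upNeighbors_nestedGraph i, Finset.sum_image Fin.val_injective.injOn]
  simp only [hcard]

open scoped Classical in
/-- For every positive integer `n` there is a graph `G` of order `n` maximizing `Mo*`
among all graphs of order `n` whose vertex set is partitioned into an independent set
`I` of size `n - δ` (where `δ` is the minimum degree of `G`), all of whose vertices
have degree exactly `δ`, and the complementary set `C = Iᶜ` of size `δ` such that every
vertex of `I` is adjacent to every vertex of `C`. -/
theorem stmt9 (n : ℕ) (hn : 0 < n) :
    ∃ G : SimpleGraph (Fin n),
      (∀ G' : SimpleGraph (Fin n), moStar G' ≤ moStar G) ∧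
      ∃ I : Finset (Fin n),
        I.card = n - G.minDegree ∧
        Iᶜ.card = G.minDegree ∧
        (∀ u ∈ I, ∀ v ∈ I, ¬ G.Adj u v) ∧
        (∀ v ∈ I, G.degree v = G.minDegree) ∧
        (∀ v ∈ I, ∀ w ∈ Iᶜ, G.Adj v w) := by
  have : Nonempty (Fin n) := ⟨⟨0, hn⟩⟩
  obtain ⟨G₀, hG₀⟩ := Finite.exists_max fun G : SimpleGraph (Fin n) => moStar G
  obtain ⟨a₀, ha₀, hle₀⟩ := exists_isNested_moStar_le G₀
  obtain ⟨a, ha, hle, hconst⟩ := ha₀.exists_forall_eq hn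
  have h0 : a 0 < n := by simpa using ha.add_lt 0 hn
  let G := nestedGraph n a
  let I : Finset (Fin n) := univ.filter fun i => (i : ℕ) + a 0 < n
  have hI {i : Fin n} : i ∈ I ↔ (i : ℕ) + a 0 < n := by simp [I]
  have hle_a (i : ℕ) : a i ≤ a 0 := ha.antitone i.zero_le
  have hadj {i : Fin n} (hi : i ∈ I) (j : Fin n) : G.Adj i j ↔ j ∈ Iᶜ := by
    rw [hI] at hi
    have h1 := hconst i hi
    have h2 := hle_a j
    simp only [mem_compl, hI, G, nestedGraph]
    omega
  have hIcard : #I = n - a 0 := by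
    have : I.image Fin.val = range (n - a 0) := by
      ext x
      simp only [mem_image, hI, mem_range]
      exact ⟨by rintro ⟨i, h, rfl⟩; omega, fun h => ⟨⟨x, by omega⟩, by simp only; omega, rfl⟩⟩
    rw [← card_image_of_injective _ Fin.val_injective, this, card_range]
  have hCcard : #Iᶜ = a 0 := by
    rw [card_compl, Fintype.card_fin, hIcard]
    omega
  have hdegI {i : Fin n} (hi : i ∈ I) : G.degree i = a 0 := by
    rw [← G.card_neighborFinset_eq_degree, ← hCcard]
    congr 1
    ext j
    rw [SimpleGraph.mem_neighborFinset, hadj hi]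
  have hz : (⟨0, hn⟩ : Fin n) ∈ I := hI.2 (by simpa using h0)
  have hsum := ha.sum_upNeighbors_nestedGraph
  have hmo := moStar_eq_sum_upNeighbors G Fin.val_injective
  rw [Fintype.card_fin] at hmo
  have hterm (u w : Fin n) :
      (n : ℤ) - G.degree u ≤ n - min (G.degree u : ℤ) (G.degree w) := by
    have := min_le_left (G.degree u : ℤ) (G.degree w)
    linarith
  have hGle : nestedValue n a ≤ moStar G := by
    rw [← hsum, hmo]
    exact Finset.sum_le_sum fun u _ => Finset.sum_le_sum fun w _ => hterm u w
  have hmax (G' : SimpleGraph (Fin n)) : moStar G' ≤ moStar G := by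
    refine (hG₀ G').trans ?_
    exact_mod_cast hle₀.trans (hle.trans hGle)
  have hdeg_ge (w : Fin n) : a 0 ≤ G.degree w := by
    by_contra! hw
    have hwI : w ∉ I := fun h => hw.ne (hdegI h)
    have hzw : w ∈ upNeighbors G Fin.val ⟨0, hn⟩ := by
      refine mem_upNeighbors.2 ⟨(hadj hz w).2 (mem_compl.2 hwI), ?_⟩
      rw [hI] at hwI
      simp only
      omega
    have hlt : nestedValue n a < moStar G := by
      rw [← hsum, hmo]
      refine Finset.sum_lt_sum (fun u _ => Finset.sum_le_sum fun w _ => hterm u w)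
        ⟨⟨0, hn⟩, mem_univ _, Finset.sum_lt_sum (fun w _ => hterm _ w) ⟨w, hzw, ?_⟩⟩
      have h1 := min_le_right (G.degree ⟨0, hn⟩ : ℤ) (G.degree w)
      have h2 : G.degree w < G.degree ⟨0, hn⟩ := by rwa [hdegI hz]
      have h3 : (G.degree w : ℤ) < G.degree ⟨0, hn⟩ := by exact_mod_cast h2
      change (n : ℤ) - G.degree ⟨0, hn⟩ < _
      linarith
    have := hG₀ G
    have : (moStar G : ℤ) ≤ moStar G₀ := by exact_mod_cast this
    linarith
  have hmin : G.minDegree = a 0 :=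
    le_antisymm ((G.minDegree_le_degree _).trans_eq (hdegI hz))
      (G.le_minDegree_of_forall_le_degree _ hdeg_ge)
  refine ⟨G, hmax, I, ?_, ?_, ?_, ?_, ?_⟩
  · rw [hmin, hIcard]
  · rw [hmin, hCcard]
  · intro u hu v hv h
    exact mem_compl.1 ((hadj hu v).1 h) hv
  · intro v hv
    rw [hmin, hdegI hv]
  · intro v hv w hw
    exact (hadj hv w).2 hw
end

section
/- For all real x ∈ [0,1], x(1−x)² + (2/√3 − 1)x³ ≤ 2/√3 − 1, and this maximum value 2/√3 − 1 is attained, i.e., max{x(1−x)² + (2/√3 − 1)x³ : x ∈ [0,1]} = 2/√3 − 1. -/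
theorem stmt10 :
    (∀ x ∈ Set.Icc (0 : ℝ) 1,
        x * (1 - x) ^ 2 + (2 / Real.sqrt 3 - 1) * x ^ 3 ≤ 2 / Real.sqrt 3 - 1) ∧
    (∃ x ∈ Set.Icc (0 : ℝ) 1,
        x * (1 - x) ^ 2 + (2 / Real.sqrt 3 - 1) * x ^ 3 = 2 / Real.sqrt 3 - 1) := by
  have hk : 0 < 2 / Real.sqrt 3 := by positivity
  have hk2 : 3 * (2 / Real.sqrt 3) ^ 2 = 4 := by
    rw [div_pow, Real.sq_sqrt (by norm_num)]
    norm_num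
  generalize 2 / Real.sqrt 3 = k at hk hk2 ⊢
  refine ⟨fun x hx => ?_, 1, by norm_num, by norm_num⟩
  have hq : 0 ≤ k * x ^ 2 - (2 - k) * x + (k - 1) := by
    refine nonneg_of_mul_nonneg_right ?_ hk
    linarith [sq_nonneg (k * x - (2 - k) / 2)]
  linarith [mul_nonneg (sub_nonneg.2 hx.2) hq]
end

section
/- Let n and Δ be positive integers with Δ ≤ n − 1, let G be a finite simple graph of order n with maximum degree at most Δ, and let p be a real number and q : {0,1,…,Δ} → ℝ satisfy q_i + q_j ≥ 1 − i/n for all i, j ∈ {0,1,…,Δ} with i ≤ j, and p ≥ (i/n)·q_i for all i ∈ {0,1,…,Δ}. Then Mo*(G) ≤ p·n³. -/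
open Finset

/-- Handshake identity with vertex weights: summing the weights of both endpoints over all edges
counts each vertex with multiplicity its degree. -/
theorem sum_edgeFinset_lift_add {V : Type*} [Fintype V] [DecidableEq V] (G : SimpleGraph V)
    [DecidableRel G.Adj] (f : V → ℝ) :
    ∑ e ∈ G.edgeFinset, Sym2.lift ⟨fun u v => f u + f v, fun _ _ => add_comm _ _⟩ e =
      ∑ v, (G.degree v : ℝ) * f v := by
  have h : ∀ e ∈ G.edgeFinset, Sym2.lift ⟨fun u v => f u + f v, fun _ _ => add_comm _ _⟩ e =
      ∑ w, if w ∈ e then f w else 0 := by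
    intro e he
    induction e with
    | h u v =>
      have huv : u ≠ v := (SimpleGraph.mem_edgeFinset.1 he : G.Adj u v).ne
      have hs : (univ.filter fun w => w ∈ s(u, v)) = {u, v} := by
        ext w
        simp
      rw [← sum_filter, hs, sum_pair huv, Sym2.lift_mk]
  rw [sum_congr rfl h, sum_comm]
  refine sum_congr rfl fun w _ => ?_
  rw [← sum_filter, sum_const, nsmul_eq_mul, ← G.card_incidenceFinset_eq_degree w,
    G.incidenceFinset_eq_filter w]

open scoped Classical in
theorem stmt12 {V : Type*} [Fintype V] (n Δ : ℕ) (hn : 0 < n) (hΔ : 0 < Δ)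
    (hΔn : Δ ≤ n - 1) (G : SimpleGraph V) (hV : Fintype.card V = n)
    (hmax : G.maxDegree ≤ Δ) (p : ℝ) (q : ℕ → ℝ)
    (hq : ∀ i j : ℕ, i ≤ j → j ≤ Δ → 1 - (i : ℝ) / n ≤ q i + q j)
    (hp : ∀ i : ℕ, i ≤ Δ → ((i : ℝ) / n) * q i ≤ p) :
    (moStar G : ℝ) ≤ p * n ^ 3 := by
  have hn' : (0 : ℝ) < n := by exact_mod_cast hn
  have hd : ∀ v, G.degree v ≤ Δ := fun v => (G.degree_le_maxDegree v).trans hmax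
  have hmin : ∀ i j : ℕ, i ≤ Δ → j ≤ Δ →
      ((n - min i j : ℕ) : ℝ) ≤ n * q i + n * q j := by
    have key : ∀ i j : ℕ, i ≤ j → j ≤ Δ → ((n - i : ℕ) : ℝ) ≤ n * q i + n * q j := by
      intro i j hij hj
      rw [Nat.cast_sub (by omega)]
      calc (n : ℝ) - i = n * (1 - (i : ℝ) / n) := by field_simp
        _ ≤ n * (q i + q j) := mul_le_mul_of_nonneg_left (hq i j hij hj) hn'.le
        _ = n * q i + n * q j := mul_add _ _ _
    intro i j hi hj
    rcases le_total i j with h | h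
    · rw [min_eq_left h]
      exact key i j h hj
    · rw [min_eq_right h, add_comm]
      exact key j i h hi
  calc (moStar G : ℝ)
      ≤ ∑ e ∈ G.edgeFinset, Sym2.lift ⟨fun u v => n * q (G.degree u) + n * q (G.degree v),
          fun _ _ => add_comm _ _⟩ e := by
        unfold moStar
        push_cast
        refine (sum_le_sum fun e _ => ?_).trans_eq (sum_congr (by congr!) fun _ _ => rfl)
        induction e with
        | h u v =>
          simp only [Sym2.lift_mk, hV]
          convert hmin (G.degree u) (G.degree v) (hd u) (hd v)
    _ = ∑ v, (G.degree v : ℝ) * (n * q (G.degree v)) :=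
        sum_edgeFinset_lift_add G fun v => n * q (G.degree v)
    _ ≤ ∑ _v : V, p * n ^ 2 := by
        refine sum_le_sum fun v _ => ?_
        calc (G.degree v : ℝ) * (n * q (G.degree v))
            = ((G.degree v : ℝ) / n * q (G.degree v)) * n ^ 2 := by field_simp
          _ ≤ p * n ^ 2 := mul_le_mul_of_nonneg_right (hp _ (hd v)) (by positivity)
    _ = p * n ^ 3 := by
        rw [sum_const, card_univ, hV, nsmul_eq_mul]
        ring
end

section
/- For every real ε > 0 there exists a positive integer n₀ such that for every integer n ≥ n₀ there is a finite simple graph G of order n with Mo*(G) ≥ (2/√3 − 1 − ε)·n³. In particular, the bound Mo*(G) ≤ (2/√3 − 1)n³ is best possible up to terms of lower order. -/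
open Finset

theorem SimpleGraph.two_mul_sum_edgeFinset {V M : Type*} [Fintype V] [DecidableEq V]
    [NonAssocSemiring M] (G : SimpleGraph V) [DecidableRel G.Adj] (f : Sym2 V → M) :
    2 * ∑ e ∈ G.edgeFinset, f e = ∑ u, ∑ v, if G.Adj u v then f s(u, v) else 0 := by
  have hdart : ∑ d : G.Dart, f d.edge = 2 * ∑ e ∈ G.edgeFinset, f e := by
    rw [← sum_fiberwise_of_maps_to (s := univ) (t := G.edgeFinset) (g := Dart.edge)
      (fun d _ => mem_edgeFinset.2 d.edge_mem), mul_sum]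
    refine sum_congr rfl fun e he => ?_
    rw [sum_congr rfl (g := fun _ => f e) (fun d hd => by rw [(mem_filter.1 hd).2]), sum_const,
      G.dart_edge_fiber_card e (mem_edgeFinset.1 he), nsmul_eq_mul, Nat.cast_ofNat]
  rw [← hdart, ← Fintype.sum_prod_type', ← sum_filter]
  refine sum_bij' (fun d _ => (d.fst, d.snd)) (fun p h => ⟨p, (mem_filter.1 h).2⟩) ?_ ?_ ?_ ?_ ?_
    <;> simp [Dart.edge]

theorem two_mul_moStar {V : Type*} [Fintype V] (G : SimpleGraph V) [hG : DecidableRel G.Adj] :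
    2 * moStar G = ∑ u, ∑ v,
      if G.Adj u v then Fintype.card V - min (G.degree u) (G.degree v) else 0 := by
  let := Classical.decEq V
  obtain rfl : hG = Classical.decRel G.Adj := Subsingleton.elim _ _
  exact @SimpleGraph.two_mul_sum_edgeFinset _ _ _ _ _ G (Classical.decRel _) _

/-- The join of a graph on `m` vertices with an edgeless graph on `k` vertices. -/
def SimpleGraph.joinEmpty {m : ℕ} (H : SimpleGraph (Fin m)) (k : ℕ) :
    SimpleGraph (Fin (m + k)) where
  Adj u v := Fin.addCases
    (fun i => Fin.addCases (fun j => H.Adj i j) (fun _ => True) v)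
    (fun _ => Fin.addCases (fun _ => True) (fun _ => False) v) u
  symm := ⟨by
    intro u v
    cases u using Fin.addCases <;> cases v using Fin.addCases <;> simp [H.adj_comm]⟩
  loopless := ⟨by
    intro u
    cases u using Fin.addCases <;> simp⟩

theorem SimpleGraph.degree_eq_sum_ite {V : Type*} [Fintype V] (G : SimpleGraph V)
    [DecidableRel G.Adj] (u : V) : G.degree u = ∑ v, if G.Adj u v then 1 else 0 := by
  rw [← card_neighborFinset_eq_degree, neighborFinset_eq_filter, card_filter]

theorem moStar_joinEmpty {m : ℕ} (H : SimpleGraph (Fin m)) (k : ℕ) :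
    moStar H + m * k ^ 2 ≤ moStar (H.joinEmpty k) := by
  classical
  have hll (i j : Fin m) :
      (H.joinEmpty k).Adj (Fin.castAdd k i) (Fin.castAdd k j) ↔ H.Adj i j := by
    simp [SimpleGraph.joinEmpty]
  have hlr (i : Fin m) (j : Fin k) :
      (H.joinEmpty k).Adj (Fin.castAdd k i) (Fin.natAdd m j) ↔ True := by
    simp [SimpleGraph.joinEmpty]
  have hrl (i : Fin k) (j : Fin m) :
      (H.joinEmpty k).Adj (Fin.natAdd m i) (Fin.castAdd k j) ↔ True := by
    simp [SimpleGraph.joinEmpty]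
  have hrr (i j : Fin k) :
      (H.joinEmpty k).Adj (Fin.natAdd m i) (Fin.natAdd m j) ↔ False := by
    simp [SimpleGraph.joinEmpty]
  have hdl (i : Fin m) : (H.joinEmpty k).degree (Fin.castAdd k i) = H.degree i + k := by
    simp [SimpleGraph.degree_eq_sum_ite, Fin.sum_univ_add, hll, hlr, -sum_boole]
  have hdr (j : Fin k) : (H.joinEmpty k).degree (Fin.natAdd m j) = m := by
    simp [SimpleGraph.degree_eq_sum_ite, Fin.sum_univ_add, hrl, hrr, -sum_boole]
  have hinner : ∑ i, ∑ j, (if H.Adj i j then m + k - min (H.degree i + k) (H.degree j + k) else 0)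
      = 2 * moStar H := by
    rw [two_mul_moStar]
    refine sum_congr rfl fun i _ => sum_congr rfl fun j _ => ?_
    rw [Fintype.card_fin, min_add_add_right, Nat.add_sub_add_right]
  have hcross : ∑ i : Fin m, ∑ _j : Fin k, k ≤
      ∑ i : Fin m, ∑ _j : Fin k, (m + k - min (H.degree i + k) m) :=
    sum_le_sum fun i _ => sum_le_sum fun _ _ => by omega
  have hcross' : ∑ _j : Fin k, ∑ i : Fin m, k ≤
      ∑ _j : Fin k, ∑ i : Fin m, (m + k - min m (H.degree i + k)) :=
    sum_le_sum fun i _ => sum_le_sum fun _ _ => by omega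
  have key : 2 * (moStar H + m * k ^ 2) ≤ 2 * moStar (H.joinEmpty k) := by
    rw [two_mul_moStar (H.joinEmpty k)]
    simp only [Fin.sum_univ_add, hll, hlr, hrl, hrr, hdl, hdr, if_true, if_false,
      Fintype.card_fin, sum_add_distrib, hinner]
    simp only [sum_const_zero, sum_const, card_univ, Fintype.card_fin, smul_eq_mul] at *
    nlinarith
  omega

/-- One step of the recursion: if `a` is the positive root of `2 a ^ 2 + 2 a = 1` and `m = ⌊a n⌋`,
the lower bound `(4 a - 1) / 3 * m ^ 3 - m ^ 2` propagates from `m` to `n`. -/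
theorem cubic_bound_step {a x m : ℝ} (ha : 2 * a ^ 2 + 2 * a = 1) (ha₁ : 1 / 3 ≤ a)
    (ha₂ : a ≤ 2 / 5) (hx : 1 ≤ x) (hm : 0 ≤ m) (hle : m ≤ a * x) (hlt : a * x < m + 1) :
    (4 * a - 1) / 3 * x ^ 3 - x ^ 2 ≤ (4 * a - 1) / 3 * m ^ 3 - m ^ 2 + m * (x - m) ^ 2 := by
  have hk : ((1 - a) * x) ^ 2 ≤ (x - m) ^ 2 := by
    apply pow_le_pow_left₀ <;> nlinarith
  have hcross : (a * x - 1) * ((1 - a) * x) ^ 2 ≤ m * (x - m) ^ 2 := by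
    nlinarith [mul_le_mul_of_nonneg_left hk hm, sq_nonneg ((1 - a) * x)]
  have hcube : (a * x) ^ 3 - 3 * (a * x) ^ 2 ≤ m ^ 3 := by
    nlinarith [mul_nonneg hm (sub_nonneg.2 hle), sq_nonneg (a * x), sq_nonneg m,
      mul_nonneg (sub_nonneg.2 hlt.le) (sq_nonneg (a * x)),
      mul_nonneg (sub_nonneg.2 hlt.le) (sq_nonneg m),
      mul_nonneg (sub_nonneg.2 hlt.le) (mul_nonneg hm (hm.trans hle))]
  have hsq : m ^ 2 ≤ (a * x) ^ 2 := pow_le_pow_left₀ hm hle 2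
  have hlead : (4 * a - 1) / 3 = a * (1 - a) ^ 2 + (4 * a - 1) / 3 * a ^ 3 := by
    have h2 : a ^ 2 = 1 / 2 - a := by linarith
    have h3 : a ^ 3 = 3 / 2 * a - 1 / 2 := by
      rw [pow_succ, h2]; linarith
    have h4 : a * (1 - a) ^ 2 = a - 2 * a ^ 2 + a ^ 3 := by ring
    rw [h4, h3]
    linarith
  have hlow : (1 - a) ^ 2 + (4 * a - 1) * a ^ 2 + a ^ 2 ≤ 1 := by
    nlinarith
  have hlow' := mul_le_mul_of_nonneg_right hlow (sq_nonneg x)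
  have hcube' := mul_le_mul_of_nonneg_left hcube (show 0 ≤ (4 * a - 1) / 3 by linarith)
  have hlead' : (4 * a - 1) / 3 * x ^ 3 = (a * (1 - a) ^ 2 + (4 * a - 1) / 3 * a ^ 3) * x ^ 3 := by
    rw [← hlead]
  linarith

theorem exists_le_moStar {a : ℝ} (ha : 2 * a ^ 2 + 2 * a = 1) (ha₁ : 1 / 3 ≤ a)
    (ha₂ : a ≤ 2 / 5) (n : ℕ) :
    ∃ G : SimpleGraph (Fin n), (4 * a - 1) / 3 * (n : ℝ) ^ 3 - (n : ℝ) ^ 2 ≤ moStar G := by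
  induction n using Nat.strong_induction_on with
  | _ n ih =>
    rcases Nat.eq_zero_or_pos n with rfl | hn
    · exact ⟨⊥, by simp⟩
    have hn' : (1 : ℝ) ≤ n := by exact_mod_cast hn
    have hle : (⌊a * n⌋₊ : ℝ) ≤ a * n := Nat.floor_le (by nlinarith)
    have hlt : ⌊a * n⌋₊ < n := by
      have : (⌊a * n⌋₊ : ℝ) < n := by nlinarith
      exact_mod_cast this
    obtain ⟨H, hH⟩ := ih _ hlt
    have hstep := cubic_bound_step ha ha₁ ha₂ hn' (Nat.cast_nonneg _) hle (Nat.lt_floor_add_one _)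
    generalize ⌊a * n⌋₊ = m at *
    obtain ⟨k, rfl⟩ := Nat.exists_eq_add_of_le hlt.le
    refine ⟨H.joinEmpty k, ?_⟩
    have hjoin : (moStar H : ℝ) + m * (k : ℝ) ^ 2 ≤ moStar (H.joinEmpty k) := by
      exact_mod_cast moStar_joinEmpty H k
    have hk : ((m + k : ℕ) : ℝ) - m = k := by push_cast; ring
    rw [hk] at hstep
    linarith

/-- The bound `Mo*(G) ≤ (2/√3 - 1) n³` is best possible up to terms of lower order. -/
theorem stmt15 (ε : ℝ) (hε : 0 < ε) :
    ∃ n₀ : ℕ, 0 < n₀ ∧ ∀ n : ℕ, n₀ ≤ n →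
      ∃ G : SimpleGraph (Fin n),
        (2 / Real.sqrt 3 - 1 - ε) * (n : ℝ) ^ 3 ≤ (moStar G : ℝ) := by
  obtain ⟨N, hN⟩ := exists_nat_gt (1 / ε)
  refine ⟨N + 1, N.succ_pos, fun n hn => ?_⟩
  have hs : √(3 : ℝ) ^ 2 = 3 := Real.sq_sqrt (by norm_num)
  have hs₀ : (0 : ℝ) < √3 := by positivity
  obtain ⟨G, hG⟩ := exists_le_moStar (a := (√3 - 1) / 2) (by linarith)
    (by nlinarith) (by nlinarith) n
  refine ⟨G, le_trans ?_ hG⟩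
  have hc : (4 * ((√3 - 1) / 2) - 1) / 3 = 2 / √3 - 1 := by
    field_simp
    linarith
  rw [hc]
  have hNn : (N : ℝ) + 1 ≤ n := by exact_mod_cast hn
  have hεn : 1 ≤ ε * n := by
    rw [div_lt_iff₀ hε] at hN
    nlinarith
  nlinarith [mul_le_mul_of_nonneg_right hεn (sq_nonneg (n : ℝ))]
end
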